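/- arXiv:1203.0477 — 3 statements merged into one kernel-verified Lean document; each statement's English description precedes it below -/
import Mathlib

section
/- Let α ∈ (0, 2] and β ∈ (0, 1). There exists a constant C > 0, depending only on α and β, such that for every probability measure μ on ℝ whose characteristic function satisfies ∫_ℝ e^{iξy} dμ(y) = e^{−|ξ|^α} for all ξ ∈ ℝ, every x ∈ ℝ, and every ε > 0, one has ∫_ℝ |x + ε y|^{−β} dμ(y) ≤ C ε^{−β}. -/
open MeasureTheory

/-- The stable characteristic function is integrable. -/
theorem stable_aux_integrable (α : ℝ) (hα : 0 < α) :
    Integrable (fun x : ℝ => Real.exp (-|x| ^ α)) := by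
  apply Integrable.of_integral_ne_zero
  rw [integral_comp_abs (f := fun x => Real.exp (-x ^ α)), integral_exp_neg_rpow hα]
  have := Real.Gamma_pos_of_pos (s := 1 / α + 1) (by positivity)
  positivity

/-- Gaussian-smoothed mass bound. -/
theorem stable_aux_gauss (α : ℝ) (hα : 0 < α) (μ : Measure ℝ) [IsProbabilityMeasure μ]
    (h : ∀ ξ : ℝ, ∫ y : ℝ, Complex.exp (Complex.I * ξ * y) ∂μ = (Real.exp (-|ξ| ^ α) : ℂ))
    (a r : ℝ) (hr : 0 < r) :
    ∫ y, Real.exp (-((y - a) / r) ^ 2 / 2) ∂μ ≤ r * ∫ x : ℝ, Real.exp (-|x| ^ α) := by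
  set v : NNReal := ⟨(1 / r) ^ 2, by positivity⟩ with hv
  have hvr : (v : ℝ) = (1 / r) ^ 2 := rfl
  have hv0 : v ≠ 0 := by
    intro h0
    have : (v : ℝ) = 0 := by rw [h0]; rfl
    rw [hvr] at this
    have : 0 < (1 / r) ^ 2 := by positivity
    linarith
  set ν := ProbabilityTheory.gaussianReal 0 v with hν
  have key : ((∫ y, Real.exp (-((y - a) / r) ^ 2 / 2) ∂μ : ℝ) : ℂ)
      = ∫ x : ℝ, Complex.exp (-a * x * Complex.I) * (Real.exp (-|x| ^ α) : ℂ) ∂ν := by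
    rw [← integral_complex_ofReal]
    have h1 : ∀ y : ℝ, ((Real.exp (-((y - a) / r) ^ 2 / 2) : ℝ) : ℂ)
        = ∫ x : ℝ, Complex.exp ((y - a) * x * Complex.I) ∂ν := by
      intro y
      have h2 := ProbabilityTheory.charFun_gaussianReal (μ := 0) (v := v) (y - a)
      rw [charFun_apply_real] at h2
      push_cast at h2
      rw [h2]
      have h3 : ((v : ℝ) : ℂ) = ((1 / r) ^ 2 : ℝ) := by rw [hvr]
      have h4 : ((v : NNReal) : ℂ) = ((v : ℝ) : ℂ) := rfl
      rw [h3]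
      push_cast
      congr 1
      ring
    simp_rw [h1]
    rw [integral_integral_swap]
    · congr 1
      ext x
      rw [← h x, ← integral_const_mul]
      congr 1
      ext y
      rw [← Complex.exp_add]
      congr 1
      ring
    · apply Integrable.mono' (integrable_const (1 : ℝ))
      · apply Continuous.aestronglyMeasurable
        unfold Function.uncurry
        fun_prop
      · refine Filter.Eventually.of_forall fun p => ?_
        have : ((p.1 : ℂ) - a) * p.2 * Complex.I = (((p.1 - a) * p.2 : ℝ) : ℂ) * Complex.I := by
          push_cast; ring
        simp only [Function.uncurry]
        rw [this, Complex.norm_exp_ofReal_mul_I]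
  have hint := stable_aux_integrable α hα
  calc ∫ y, Real.exp (-((y - a) / r) ^ 2 / 2) ∂μ
      ≤ ‖((∫ y, Real.exp (-((y - a) / r) ^ 2 / 2) ∂μ : ℝ) : ℂ)‖ := by
        rw [Complex.norm_real]; exact le_abs_self _
    _ ≤ ∫ x : ℝ, Real.exp (-|x| ^ α) ∂ν := by
        rw [key]
        refine (norm_integral_le_integral_norm _).trans (le_of_eq ?_)
        congr 1
        ext x
        have : (-(a : ℂ)) * x * Complex.I = ((-a * x : ℝ) : ℂ) * Complex.I := by
          push_cast; ring
        rw [norm_mul, this, Complex.norm_exp_ofReal_mul_I, Complex.norm_real, one_mul,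
          Real.norm_eq_abs, abs_of_pos (Real.exp_pos _)]
    _ = ∫ x : ℝ, ProbabilityTheory.gaussianPDFReal 0 v x • Real.exp (-|x| ^ α) :=
        ProbabilityTheory.integral_gaussianReal_eq_integral_smul hv0
    _ ≤ ∫ x : ℝ, r * Real.exp (-|x| ^ α) := by
        apply integral_mono_of_nonneg
        · refine Filter.Eventually.of_forall fun x => ?_
          exact mul_nonneg (ProbabilityTheory.gaussianPDFReal_nonneg _ _ _) (Real.exp_pos _).le
        · exact hint.const_mul r
        · refine Filter.Eventually.of_forall fun x => ?_
          refine mul_le_mul_of_nonneg_right ?_ (Real.exp_pos _).le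
          rw [ProbabilityTheory.gaussianPDFReal_def]
          have e1 : Real.exp (-(x - 0) ^ 2 / (2 * v)) ≤ 1 := by
            rw [Real.exp_le_one_iff, neg_div]
            have : 0 ≤ (x - 0) ^ 2 / (2 * (v : ℝ)) := by positivity
            linarith
          have e2 : (√(2 * Real.pi * v))⁻¹ ≤ r := by
            have : 1 / r ≤ √(2 * Real.pi * v) := by
              apply Real.le_sqrt_of_sq_le
              rw [hvr]
              have : 0 ≤ (1 / r) ^ 2 := by positivity
              nlinarith [Real.pi_gt_three]
            calc _ ≤ (1 / r)⁻¹ := inv_anti₀ (by positivity) this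
              _ = r := by simp
          calc _ ≤ (√(2 * Real.pi * v))⁻¹ * 1 := mul_le_mul_of_nonneg_left e1 (by positivity)
            _ ≤ r := by rw [mul_one]; exact e2
    _ = _ := integral_const_mul _ _

/-- Small ball bound. -/
theorem stable_aux_ball (α : ℝ) (hα : 0 < α) (μ : Measure ℝ) [IsProbabilityMeasure μ]
    (h : ∀ ξ : ℝ, ∫ y : ℝ, Complex.exp (Complex.I * ξ * y) ∂μ = (Real.exp (-|ξ| ^ α) : ℂ))
    (a r : ℝ) (hr : 0 < r) :
    μ {y | |a + y| ≤ r} ≤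
      ENNReal.ofReal ((Real.exp (1 / 2) * ∫ x : ℝ, Real.exp (-|x| ^ α)) * r) := by
  have h1 := stable_aux_gauss α hα μ h (-a) r hr
  have h2 : Real.exp (-(1 / 2)) * μ.real {y | Real.exp (-(1 / 2)) ≤
      Real.exp (-((y - -a) / r) ^ 2 / 2)} ≤ _ :=
    mul_meas_ge_le_integral_of_nonneg (Filter.Eventually.of_forall fun y => (Real.exp_pos _).le)
      (by
        apply Integrable.mono' (integrable_const (1 : ℝ))
        · apply Continuous.aestronglyMeasurable
          fun_prop
        · refine Filter.Eventually.of_forall fun y => ?_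
          rw [Real.norm_eq_abs, abs_of_pos (Real.exp_pos _), Real.exp_le_one_iff, neg_div]
          have : 0 ≤ ((y - -a) / r) ^ 2 / 2 := by positivity
          linarith) _
  have h3 : {y | |a + y| ≤ r} ⊆ {y | Real.exp (-(1 / 2)) ≤
      Real.exp (-((y - -a) / r) ^ 2 / 2)} := by
    intro y hy
    simp only [Set.mem_setOf_eq] at hy ⊢
    rw [Real.exp_le_exp]
    have : |(y - -a) / r| ≤ 1 := by
      rw [abs_div, abs_of_pos hr, div_le_one hr, sub_neg_eq_add, add_comm]
      exact hy
    have := (sq_le_one_iff_abs_le_one _).2 this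
    linarith
  refine (measure_mono h3).trans ?_
  rw [← ofReal_measureReal]
  apply ENNReal.ofReal_le_ofReal
  have h4 := mul_le_mul_of_nonneg_left (h2.trans h1) (Real.exp_pos (1 / 2)).le
  rw [← mul_assoc, ← Real.exp_add] at h4
  norm_num at h4 ⊢
  linarith

theorem stable_aux_moment (α β : ℝ) (hα : 0 < α) (hβ : β ∈ Set.Ioo (0 : ℝ) 1)
    (μ : Measure ℝ) [IsProbabilityMeasure μ]
    (h : ∀ ξ : ℝ, ∫ y : ℝ, Complex.exp (Complex.I * ξ * y) ∂μ = (Real.exp (-|ξ| ^ α) : ℂ))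
    (a : ℝ) :
    ∫⁻ y : ℝ, ENNReal.ofReal (|a + y| ^ (-β)) ∂μ ≤
      ENNReal.ofReal (1 + ∫ t in Set.Ioi (1 : ℝ),
        (Real.exp (1 / 2) * ∫ x : ℝ, Real.exp (-|x| ^ α)) * t ^ (-1 / β)) := by
  obtain ⟨hb0, hb1⟩ := hβ
  set K := Real.exp (1 / 2) * ∫ x : ℝ, Real.exp (-|x| ^ α) with hK
  have hK0 : 0 ≤ K :=
    mul_nonneg (Real.exp_pos _).le (integral_nonneg fun x => (Real.exp_pos _).le)
  have hint : IntegrableOn (fun t : ℝ => K * t ^ (-1 / β)) (Set.Ioi 1) := by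
    apply Integrable.const_mul
    apply integrableOn_Ioi_rpow_of_lt _ one_pos
    rw [neg_div, neg_lt_neg_iff, lt_div_iff₀ hb0]
    linarith
  rw [lintegral_eq_lintegral_meas_le μ (Filter.Eventually.of_forall fun y => by positivity)
    (by fun_prop)]
  rw [← Set.Ioc_union_Ioi_eq_Ioi (zero_le_one' ℝ), lintegral_union measurableSet_Ioi
    (Set.Ioc_disjoint_Ioi le_rfl)]
  rw [ENNReal.ofReal_add zero_le_one (setIntegral_nonneg measurableSet_Ioi fun t ht =>
    mul_nonneg hK0 (Real.rpow_nonneg (zero_le_one.trans (le_of_lt ht)) _))]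
  gcongr
  · calc _ ≤ ∫⁻ t in Set.Ioc (0 : ℝ) 1, 1 := lintegral_mono fun t => prob_le_one
      _ = _ := by simp
  · rw [ofReal_integral_eq_lintegral_ofReal hint]
    · apply setLIntegral_mono' measurableSet_Ioi
      intro t ht
      have ht1 : 1 < t := ht
      have ht0 : 0 < t := by linarith
      refine le_trans (measure_mono ?_) (stable_aux_ball α hα μ h a (t ^ (-1 / β)) (by positivity))
      intro y hy
      simp only [Set.mem_setOf_eq] at hy ⊢
      rcases (abs_nonneg (a + y)).eq_or_lt with h0 | h0
      · rw [← h0]; positivity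
      · have := Real.rpow_le_rpow_of_nonpos ht0 hy (z := -1 / β)
          (by rw [neg_div]; have : 0 < 1 / β := by positivity
              linarith)
        rw [← Real.rpow_mul h0.le] at this
        have e : -β * (-1 / β) = 1 := by field_simp
        rwa [e, Real.rpow_one] at this
    · refine (ae_restrict_iff' measurableSet_Ioi).2 (Filter.Eventually.of_forall fun t ht => ?_)
      exact mul_nonneg hK0 (Real.rpow_nonneg (zero_le_one.trans (le_of_lt ht)) _)

/-- For a standard symmetric `α`-stable law `μ` (characteristic function `e^{-|ξ|^α}`),
`E|x + ε Y|^{-β} ≤ C ε^{-β}` with `C` depending only on `α, β`. -/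
theorem stable_negative_moment_bound (α β : ℝ) (hα : α ∈ Set.Ioc (0 : ℝ) 2)
    (hβ : β ∈ Set.Ioo (0 : ℝ) 1) :
    ∃ C : ℝ, 0 < C ∧ ∀ μ : Measure ℝ, IsProbabilityMeasure μ →
      (∀ ξ : ℝ, ∫ y : ℝ, Complex.exp (Complex.I * ξ * y) ∂μ = (Real.exp (-|ξ| ^ α) : ℂ)) →
      ∀ x ε : ℝ, 0 < ε →
        ∫⁻ y : ℝ, ENNReal.ofReal (|x + ε * y| ^ (-β)) ∂μ ≤ ENNReal.ofReal (C * ε ^ (-β)) := by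
  have hC : 0 < 1 + ∫ t in Set.Ioi (1 : ℝ),
        (Real.exp (1 / 2) * ∫ x : ℝ, Real.exp (-|x| ^ α)) * t ^ (-1 / β) := by
    refine add_pos_of_pos_of_nonneg one_pos (setIntegral_nonneg measurableSet_Ioi fun t ht => ?_)
    exact mul_nonneg (mul_nonneg (Real.exp_pos _).le (integral_nonneg fun x => (Real.exp_pos _).le))
      (Real.rpow_nonneg (zero_le_one.trans (le_of_lt ht)) _)
  refine ⟨_, hC, ?_⟩
  intro μ hμ h x ε hε
  have h1 := stable_aux_moment α β hα.1 hβ μ h (x / ε)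
  have h2 : ∀ y : ℝ, ENNReal.ofReal (|x + ε * y| ^ (-β)) =
      ENNReal.ofReal (ε ^ (-β)) * ENNReal.ofReal (|x / ε + y| ^ (-β)) := by
    intro y
    rw [← ENNReal.ofReal_mul (by positivity), ← Real.mul_rpow hε.le (abs_nonneg _)]
    congr 2
    rw [← abs_of_pos hε, ← abs_mul, abs_of_pos hε]
    congr 1
    field_simp
  simp_rw [h2]
  rw [lintegral_const_mul' _ _ ENNReal.ofReal_ne_top, mul_comm, ENNReal.ofReal_mul hC.le]
  gcongr
end

section
/- Fix an integer d ≥ 1 and β₁, …, β_d ∈ (0, 1). There exists a constant C > 0 such that for all ε > 0, ε′ > 0 and all x, y ∈ ℝ^d with x_i ≠ y_i for every i = 1, …, d, ∫_{ℝ^d × ℝ^d} (∏_{i=1}^d p_ε(x_i + z_i)) (∏_{i=1}^d p_{ε′}(y_i + w_i)) ∏_{i=1}^d |z_i − w_i|^{−β_i} dz dw ≤ C ∏_{i=1}^d |x_i − y_i|^{−β_i}. -/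
open MeasureTheory

/-- The one-dimensional heat kernel `p_ε(x) = (2πε)^{-1/2} exp(-x²/(2ε))`. -/
noncomputable def heatKernel (ε x : ℝ) : ℝ :=
  (2 * Real.pi * ε) ^ (-(1 : ℝ) / 2) * Real.exp (-x ^ 2 / (2 * ε))

lemma hk_lintegral_prod : ∀ (d : ℕ) (f : Fin d → ℝ → ENNReal) (_ : ∀ i, Measurable (f i)),
    ∫⁻ z : Fin d → ℝ, ∏ i, f i (z i) = ∏ i, ∫⁻ t, f i t := by
  intro d
  induction d with
  | zero => intro f _; simp [volume_pi]
  | succ n ih =>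
    intro f hf
    have h := (volume_preserving_piFinSuccAbove (fun _ : Fin (n + 1) => ℝ) 0).symm
    rw [← h.lintegral_comp_emb (MeasurableEquiv.measurableEmbedding _)]
    simp only [MeasurableEquiv.piFinSuccAbove_symm_apply, Fin.insertNthEquiv, Fin.prod_univ_succ,
      Fin.insertNth_zero, Equiv.coe_fn_mk, Fin.cons_zero, Fin.cons_succ, cast_eq]
    rw [Measure.volume_eq_prod]
    rw [lintegral_prod_mul (f := f 0) (g := fun z : Fin n → ℝ => ∏ i : Fin n, f i.succ (z i))
      (hf 0).aemeasurable
      (Finset.measurable_prod _ fun i _ => (hf i.succ).comp (measurable_pi_apply i)).aemeasurable]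
    rw [ih _ fun i => hf i.succ]

lemma hk_eq (ε : ℝ) (hε : 0 < ε) (x : ℝ) :
    heatKernel ε x = ProbabilityTheory.gaussianPDFReal 0 ⟨ε, hε.le⟩ x := by
  unfold heatKernel ProbabilityTheory.gaussianPDFReal
  rw [neg_div, Real.rpow_neg (by positivity), ← Real.sqrt_eq_rpow, sub_zero]
  rfl

lemma hk_nonneg (ε : ℝ) (hε : 0 < ε) (x : ℝ) : 0 ≤ heatKernel ε x := by
  unfold heatKernel; positivity

lemma hk_meas (ε : ℝ) : Measurable (heatKernel ε) := by
  unfold heatKernel; fun_prop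

lemma hk_int (ε : ℝ) (hε : 0 < ε) : ∫⁻ x, ENNReal.ofReal (heatKernel ε x) = 1 := by
  simp_rw [hk_eq ε hε]
  apply ProbabilityTheory.lintegral_gaussianPDFReal_eq_one
  intro h
  exact hε.ne' (congrArg NNReal.toReal h)

lemma hk_le (ε : ℝ) (hε : 0 < ε) (x : ℝ) : heatKernel ε x * |x| ≤ 1 := by
  unfold heatKernel
  rw [neg_div, Real.rpow_neg (by positivity), ← Real.sqrt_eq_rpow]
  have h1 : |x| ≤ √(2 * Real.pi * ε) * Real.exp (x ^ 2 / (2 * ε)) := by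
    refine abs_le_of_sq_le_sq ?_ (by positivity)
    rw [mul_pow, Real.sq_sqrt (by positivity), ← Real.exp_nat_mul]
    have h2 := Real.add_one_le_exp (((2 : ℕ) : ℝ) * (x ^ 2 / (2 * ε)))
    have h3 : ((2 : ℕ) : ℝ) * (x ^ 2 / (2 * ε)) = x ^ 2 / ε := by push_cast; field_simp
    rw [h3] at h2 ⊢
    have h4 : ε * (x ^ 2 / ε) = x ^ 2 := by field_simp
    have h5 := Real.pi_gt_three
    have h6 : 0 ≤ x ^ 2 / ε := by positivity
    have h7 := mul_le_mul_of_nonneg_left h2 hε.le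
    have h8 : 0 < ε * Real.exp (x ^ 2 / ε) := by positivity
    nlinarith
  have h2 : (-x ^ 2 / (2 * ε)) = -(x ^ 2 / (2 * ε)) := by ring
  rw [h2, Real.exp_neg, mul_assoc, inv_mul_le_iff₀ (by positivity),
    inv_mul_le_iff₀ (by positivity)]
  linarith

lemma hk_rpow_int (b r : ℝ) (hb : b < 1) (hr : 0 < r) :
    ∫⁻ v, (Set.Ioc 0 r).indicator (fun v => ENNReal.ofReal (v ^ (-b))) v
      = ENNReal.ofReal (r ^ (1 - b) / (1 - b)) := by
  rw [lintegral_indicator measurableSet_Ioc, ← ofReal_integral_eq_lintegral_ofReal]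
  · rw [← intervalIntegral.integral_of_le hr.le, integral_rpow (Or.inl (by linarith)),
      Real.zero_rpow (by linarith)]
    congr 1
    ring_nf
  · exact (intervalIntegrable_iff_integrableOn_Ioc_of_le hr.le).1
      (intervalIntegral.intervalIntegrable_rpow' (by linarith))
  · filter_upwards [ae_restrict_mem measurableSet_Ioc] with v hv
    exact Real.rpow_nonneg hv.1.le _

lemma hk_step (b : ℝ) (hb : b ∈ Set.Ioo (0 : ℝ) 1) (ε : ℝ) (hε : 0 < ε) (a : ℝ) (ha : a ≠ 0) :
    ∫⁻ u, ENNReal.ofReal (heatKernel ε u * |u - a| ^ (-b))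
      ≤ ENNReal.ofReal ((2 + 4 / (1 - b)) * |a| ^ (-b)) := by
  obtain ⟨hb0, hb1⟩ := hb
  have ha' : 0 < |a| := abs_pos.2 ha
  set r := |a| / 2 with hr
  have hr0 : 0 < r := by positivity
  set g : ℝ → ENNReal := (Set.Ioc 0 r).indicator (fun v => ENNReal.ofReal (v ^ (-b))) with hg
  have hgm : Measurable g := Measurable.indicator (by fun_prop) measurableSet_Ioc
  have hrb : r ^ (-b) ≤ 2 * |a| ^ (-b) := by
    rw [hr, Real.div_rpow (by positivity) (by positivity), Real.rpow_neg (x := 2) (by positivity),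
      div_inv_eq_mul, mul_comm]
    gcongr
    exact Real.rpow_le_self_of_one_le (by norm_num) hb1.le
  have hpt : ∀ u, ENNReal.ofReal (heatKernel ε u * |u - a| ^ (-b)) ≤
      ENNReal.ofReal (2 * |a| ^ (-b)) * ENNReal.ofReal (heatKernel ε u) +
        ENNReal.ofReal (1 / r) * (g (u - a) + g (a - u)) := by
    intro u
    have hp := hk_nonneg ε hε u
    rcases lt_or_ge r |u - a| with h | h
    · refine le_trans ?_ le_self_add
      rw [← ENNReal.ofReal_mul (by positivity)]
      apply ENNReal.ofReal_le_ofReal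
      rw [mul_comm]
      gcongr
      exact (Real.rpow_le_rpow_of_nonpos hr0 h.le (by linarith)).trans hrb
    · refine le_trans ?_ le_add_self
      have hu : r ≤ |u| := by
        have := abs_sub_abs_le_abs_sub a u
        rw [abs_sub_comm a u] at this
        have : |a| = 2 * r := by rw [hr]; ring
        linarith
      have hpr : heatKernel ε u ≤ 1 / r := by
        rw [le_div_iff₀ hr0]
        exact (mul_le_mul_of_nonneg_left hu hp).trans (hk_le ε hε u)
      rw [ENNReal.ofReal_mul hp]
      gcongr
      rcases lt_trichotomy u a with h1 | h1 | h1
      · refine le_trans ?_ le_add_self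
        rw [abs_sub_comm, abs_of_pos (by linarith)] at h ⊢
        rw [hg, Set.indicator_of_mem (by constructor <;> linarith)]
      · subst h1
        simp [Real.zero_rpow (neg_ne_zero.2 hb0.ne')]
      · refine le_trans ?_ le_self_add
        rw [abs_of_pos (by linarith)] at h ⊢
        rw [hg, Set.indicator_of_mem (by constructor <;> linarith)]
  refine (lintegral_mono hpt).trans ?_
  have hm := hk_meas ε
  have e1 : ∫⁻ u, g (u - a) = ∫⁻ u, g u := lintegral_sub_right_eq_self g a
  have e2 : ∫⁻ u, g (a - u) = ∫⁻ u, g u := lintegral_sub_left_eq_self g a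
  rw [lintegral_add_left (by fun_prop), lintegral_const_mul _ (by fun_prop),
    lintegral_const_mul _ (by fun_prop), lintegral_add_left (by fun_prop), hk_int ε hε, e1, e2,
    hg, hk_rpow_int b r hb1 hr0, mul_one]
  have h1b : 0 < 1 - b := by linarith
  rw [← ENNReal.ofReal_add (by positivity) (by positivity), ← ENNReal.ofReal_mul (by positivity),
    ← ENNReal.ofReal_add (by positivity) (by positivity)]
  apply ENNReal.ofReal_le_ofReal
  have hs : r ^ (1 - b) = r * r ^ (-b) := by
    rw [sub_eq_add_neg, Real.rpow_add hr0, Real.rpow_one]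
  rw [hs]
  have : 1 / r * (r * r ^ (-b) / (1 - b) + r * r ^ (-b) / (1 - b)) = 2 / (1 - b) * r ^ (-b) := by
    field_simp; ring
  rw [this, add_mul]
  refine add_le_add le_rfl ?_
  calc 2 / (1 - b) * r ^ (-b) ≤ 2 / (1 - b) * (2 * |a| ^ (-b)) := by gcongr
    _ = _ := by ring

lemma hk_step' (b : ℝ) (hb : b ∈ Set.Ioo (0 : ℝ) 1) (ε : ℝ) (hε : 0 < ε) (x w : ℝ)
    (ha : x + w ≠ 0) :
    ∫⁻ z, ENNReal.ofReal (heatKernel ε (x + z) * |z - w| ^ (-b))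
      ≤ ENNReal.ofReal ((2 + 4 / (1 - b)) * |x + w| ^ (-b)) := by
  rw [← lintegral_sub_right_eq_self _ x]
  refine le_trans (le_of_eq (lintegral_congr fun u => ?_)) (hk_step b hb ε hε (x + w) ha)
  rw [add_sub_cancel, sub_sub]

lemma hk_one (b : ℝ) (hb : b ∈ Set.Ioo (0 : ℝ) 1) (ε ε' : ℝ) (hε : 0 < ε) (hε' : 0 < ε')
    (x y : ℝ) (hxy : x ≠ y) :
    ∫⁻ w, ENNReal.ofReal (heatKernel ε' (y + w)) *
      ∫⁻ z, ENNReal.ofReal (heatKernel ε (x + z) * |z - w| ^ (-b))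
      ≤ ENNReal.ofReal ((2 + 4 / (1 - b)) ^ 2 * |x - y| ^ (-b)) := by
  have h1b : 0 < 1 - b := by linarith [hb.2]
  have hm := hk_meas ε'
  calc _ ≤ ∫⁻ w, ENNReal.ofReal (2 + 4 / (1 - b)) *
        ENNReal.ofReal (heatKernel ε' (y + w) * |w - (-x)| ^ (-b)) := by
        apply lintegral_mono_ae
        filter_upwards [Measure.ae_ne volume (-x)] with w hw
        have := hk_step' b hb ε hε x w (fun h => hw (by linarith))
        refine (mul_le_mul_right this _).trans (le_of_eq ?_)
        have e : w - -x = x + w := by ring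
        rw [← ENNReal.ofReal_mul (hk_nonneg _ hε' _), ← ENNReal.ofReal_mul (by positivity), e]
        congr 1; ring
    _ ≤ _ := by
        rw [lintegral_const_mul _ (by fun_prop)]
        refine (mul_le_mul_right (hk_step' b hb ε' hε' y (-x) (fun h => hxy (by linarith))) _).trans
          (le_of_eq ?_)
        have e : y + -x = -(x - y) := by ring
        rw [← ENNReal.ofReal_mul (by positivity), e, abs_neg]
        congr 1; ring

/-- The `d`-dimensional version of the heat kernel convolution bound:
`∫ (∏ᵢ p_ε(xᵢ+zᵢ)) (∏ᵢ p_{ε'}(yᵢ+wᵢ)) ∏ᵢ |zᵢ-wᵢ|^{-βᵢ} dz dw ≤ C ∏ᵢ |xᵢ-yᵢ|^{-βᵢ}`. -/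
theorem heatKernel_convolution_bound_multidim (d : ℕ) (hd : 1 ≤ d)
    (β : Fin d → ℝ) (hβ : ∀ i, β i ∈ Set.Ioo (0 : ℝ) 1) :
    ∃ C : ℝ, 0 < C ∧ ∀ (ε ε' : ℝ) (x y : Fin d → ℝ), 0 < ε → 0 < ε' →
      (∀ i, x i ≠ y i) →
      ∫⁻ zw : (Fin d → ℝ) × (Fin d → ℝ),
          ENNReal.ofReal ((∏ i, heatKernel ε (x i + zw.1 i)) *
            (∏ i, heatKernel ε' (y i + zw.2 i)) *
            ∏ i, |zw.1 i - zw.2 i| ^ (-β i)) ≤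
        ENNReal.ofReal (C * ∏ i, |x i - y i| ^ (-β i)) := by
  have hc : ∀ i, 0 < 2 + 4 / (1 - β i) := fun i => by
    have : 0 < 1 - β i := by linarith [(hβ i).2]
    positivity
  refine ⟨∏ i, (2 + 4 / (1 - β i)) ^ 2, Finset.prod_pos fun i _ => pow_pos (hc i) 2, ?_⟩
  intro ε ε' x y hε hε' hxy
  have hm := hk_meas ε
  have hm' := hk_meas ε'
  have hmeas : Measurable fun zw : (Fin d → ℝ) × (Fin d → ℝ) =>
      ENNReal.ofReal ((∏ i, heatKernel ε (x i + zw.1 i)) *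
            (∏ i, heatKernel ε' (y i + zw.2 i)) *
            ∏ i, |zw.1 i - zw.2 i| ^ (-β i)) := by fun_prop
  have hF : ∀ i, Measurable fun w : ℝ =>
      ∫⁻ z, ENNReal.ofReal (heatKernel ε (x i + z) * |z - w| ^ (-β i)) := by
    intro i
    exact Measurable.lintegral_prod_right'
      (f := fun q : ℝ × ℝ => ENNReal.ofReal (heatKernel ε (x i + q.2) * |q.2 - q.1| ^ (-β i)))
      (by fun_prop)
  rw [Measure.volume_eq_prod, lintegral_prod_symm' _ hmeas]
  have hinner : ∀ w : Fin d → ℝ, ∫⁻ z : Fin d → ℝ,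
      ENNReal.ofReal ((∏ i, heatKernel ε (x i + z i)) *
            (∏ i, heatKernel ε' (y i + w i)) * ∏ i, |z i - w i| ^ (-β i)) =
      ∏ i, (ENNReal.ofReal (heatKernel ε' (y i + w i)) *
        ∫⁻ z, ENNReal.ofReal (heatKernel ε (x i + z) * |z - w i| ^ (-β i))) := by
    intro w
    rw [Finset.prod_mul_distrib, ← hk_lintegral_prod d
      (fun i z => ENNReal.ofReal (heatKernel ε (x i + z) * |z - w i| ^ (-β i)))
      (fun i => by fun_prop), ← lintegral_const_mul _ (by fun_prop)]
    refine lintegral_congr fun z => ?_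
    rw [← ENNReal.ofReal_prod_of_nonneg (fun i _ => hk_nonneg _ hε' _),
      ← ENNReal.ofReal_prod_of_nonneg
        (fun i _ => mul_nonneg (hk_nonneg _ hε _) (Real.rpow_nonneg (abs_nonneg _) _)),
      ← ENNReal.ofReal_mul (Finset.prod_nonneg fun i _ => hk_nonneg _ hε' _),
      Finset.prod_mul_distrib]
    congr 1; ring
  simp only [hinner]
  rw [hk_lintegral_prod d (fun i w => ENNReal.ofReal (heatKernel ε' (y i + w)) *
        ∫⁻ z, ENNReal.ofReal (heatKernel ε (x i + z) * |z - w| ^ (-β i)))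
      (fun i => Measurable.mul (by fun_prop) (hF i)),
    ← Finset.prod_mul_distrib, ENNReal.ofReal_prod_of_nonneg
      (fun i _ => mul_nonneg (sq_nonneg _) (Real.rpow_nonneg (abs_nonneg _) _))]
  exact Finset.prod_le_prod' fun i _ => hk_one (β i) (hβ i) ε ε' hε hε' (x i) (y i) (hxy i)
end

section
/- Let α ∈ (0, 2] and β ∈ (0, 1). There exists a constant C > 0 such that for every probability measure μ on ℝ whose characteristic function satisfies ∫_ℝ e^{iξx} dμ(x) = e^{−|ξ|^α} for all ξ ∈ ℝ, and every y > 0, one has ∫_ℝ (|x|^{−β} − |y + x|^{−β}) dμ(x) ≤ C · min(1, y²). -/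
open MeasureTheory

lemma K_integrable (α : ℝ) (hα : 0 < α) :
    Integrable (fun ξ : ℝ => (1 + ξ ^ 2) * Real.exp (-|ξ| ^ α)) := by
  have h0 : ∀ q : ℝ, 0 ≤ q → Integrable (fun ξ : ℝ => |ξ| ^ q * Real.exp (-|ξ| ^ α)) := by
    intro q hq
    apply Integrable.of_integral_ne_zero
    have := integral_comp_abs (f := fun x : ℝ => x ^ q * Real.exp (-x ^ α))
    rw [this, integral_rpow_mul_exp_neg_rpow hα (by linarith)]
    have := Real.Gamma_pos_of_pos (s := (q + 1) / α) (by positivity)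
    positivity
  have h1 := (h0 0 le_rfl).add (h0 2 (by norm_num))
  refine h1.congr (Filter.Eventually.of_forall fun ξ => ?_)
  simp
  ring

lemma fourier_id (α : ℝ) (μ : Measure ℝ) [IsProbabilityMeasure μ]
    (h : ∀ ξ : ℝ, ∫ x : ℝ, Complex.exp (Complex.I * ξ * x) ∂μ = (Real.exp (-|ξ| ^ α) : ℂ))
    (s : ℝ) (hs : 0 < s) (y : ℝ) :
    √(4 * Real.pi * s) * ∫ x, Real.exp (-(s * (y + x) ^ 2)) ∂μ =
      ∫ ξ : ℝ, Real.cos (ξ * y) * (Real.exp (-(1 / (4 * s)) * ξ ^ 2) * Real.exp (-|ξ| ^ α)) := by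
  have hb : 0 < 1 / (4 * s) := by positivity
  have hg := integrable_exp_neg_mul_sq hb
  have key : ∀ x : ℝ, ∫ ξ : ℝ, Complex.exp (Complex.I * (y + x) * ξ) *
      ((Real.exp (-(1 / (4 * s)) * ξ ^ 2) : ℝ) : ℂ) =
      ((√(4 * Real.pi * s) * Real.exp (-(s * (y + x) ^ 2)) : ℝ) : ℂ) := by
    intro x
    have := fourierIntegral_gaussian (b := ((1 / (4 * s) : ℝ) : ℂ)) (by simpa using hs) (y + x)
    convert this using 1
    · congr 1
      ext ξ
      push_cast
      rfl
    · push_cast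
      congr 1
      · rw [Real.sqrt_eq_rpow, Complex.ofReal_cpow (by positivity)]
        push_cast
        congr 1
        field_simp
      · congr 1
        have : (s : ℂ) ≠ 0 := by exact_mod_cast hs.ne'
        field_simp
  have hint : Integrable (fun p : ℝ × ℝ => Complex.exp (Complex.I * (y + p.1) * p.2) *
      ((Real.exp (-(1 / (4 * s)) * p.2 ^ 2) : ℝ) : ℂ)) (μ.prod volume) := by
    have h1 : Integrable (fun p : ℝ × ℝ => (1 : ℝ) * Real.exp (-(1 / (4 * s)) * p.2 ^ 2))
      (μ.prod volume) := (integrable_const (1 : ℝ)).mul_prod hg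
    refine h1.mono' (Continuous.aestronglyMeasurable (by fun_prop)) ?_
    refine Filter.Eventually.of_forall fun p => ?_
    have : Complex.I * (y + p.1) * p.2 = (((y + p.1) * p.2 : ℝ) : ℂ) * Complex.I := by
      push_cast; ring
    rw [norm_mul, this, Complex.norm_exp_ofReal_mul_I, Complex.norm_real, Real.norm_eq_abs,
      Real.abs_exp]
  have sw := integral_integral_swap (f := fun (x ξ : ℝ) => Complex.exp (Complex.I * (y + x) * ξ) *
      ((Real.exp (-(1 / (4 * s)) * ξ ^ 2) : ℝ) : ℂ)) hint
  simp only [key] at sw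
  rw [integral_complex_ofReal, integral_const_mul] at sw
  have e2 : ∀ ξ : ℝ, ∫ x : ℝ, Complex.exp (Complex.I * (y + x) * ξ) *
      ((Real.exp (-(1 / (4 * s)) * ξ ^ 2) : ℝ) : ℂ) ∂μ =
      Complex.exp ((ξ * y : ℝ) * Complex.I) *
        ((Real.exp (-(1 / (4 * s)) * ξ ^ 2) * Real.exp (-|ξ| ^ α) : ℝ) : ℂ) := by
    intro ξ
    rw [integral_mul_const]
    have : ∀ x : ℝ, Complex.exp (Complex.I * (y + x) * ξ) =
        Complex.exp ((ξ * y : ℝ) * Complex.I) * Complex.exp (Complex.I * ξ * x) := by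
      intro x
      rw [← Complex.exp_add]
      congr 1
      push_cast; ring
    simp only [this]
    rw [integral_const_mul, h]
    push_cast
    ring
  simp only [e2] at sw
  have := congrArg Complex.re sw
  rw [Complex.ofReal_re] at this
  rw [this]
  have hI : Integrable (fun ξ : ℝ => Complex.exp ((ξ * y : ℝ) * Complex.I) *
        ((Real.exp (-(1 / (4 * s)) * ξ ^ 2) * Real.exp (-|ξ| ^ α) : ℝ) : ℂ)) := by
    refine hg.mono' (Measurable.aestronglyMeasurable (by fun_prop)) ?_
    refine Filter.Eventually.of_forall fun ξ => ?_
    rw [norm_mul, Complex.norm_exp_ofReal_mul_I, Complex.norm_real, Real.norm_eq_abs,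
      abs_of_nonneg (by positivity), one_mul]
    refine mul_le_of_le_one_right (by positivity) ?_
    rw [Real.exp_le_one_iff]
    have : 0 ≤ |ξ| ^ α := by positivity
    linarith
  have := integral_re hI
  simp only [RCLike.re_eq_complex_re] at this
  rw [← this]
  congr 1
  ext ξ
  rw [Complex.re_mul_ofReal, Complex.exp_ofReal_mul_I_re]

lemma g_integrable (β : ℝ) (hβ : β ∈ Set.Ioo (0 : ℝ) 1) :
    IntegrableOn (fun s : ℝ => s ^ (β / 2 - 1) * min 1 (s ^ (-(1 / 2) : ℝ))) (Set.Ioi 0) := by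
  obtain ⟨h0, h1⟩ := hβ
  rw [← Set.Ioc_union_Ioi_eq_Ioi (zero_le_one : (0 : ℝ) ≤ 1)]
  refine IntegrableOn.union ?_ ?_
  · have : IntegrableOn (fun s : ℝ => s ^ (β / 2 - 1)) (Set.Ioc 0 1) := by
      rw [← intervalIntegrable_iff_integrableOn_Ioc_of_le zero_le_one]
      exact intervalIntegral.intervalIntegrable_rpow' (by linarith)
    refine Integrable.mono' this (Measurable.aestronglyMeasurable (by fun_prop)) ?_
    refine (ae_restrict_iff' measurableSet_Ioc).2 (Filter.Eventually.of_forall fun s hs => ?_)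
    have hs0 : 0 < s := hs.1
    rw [Real.norm_eq_abs, abs_of_nonneg (by positivity)]
    exact mul_le_of_le_one_right (by positivity) (min_le_left _ _)
  · have : IntegrableOn (fun s : ℝ => s ^ (β / 2 - 3 / 2)) (Set.Ioi 1) :=
      integrableOn_Ioi_rpow_of_lt (by linarith) one_pos
    refine Integrable.mono' this (Measurable.aestronglyMeasurable (by fun_prop)) ?_
    refine (ae_restrict_iff' measurableSet_Ioi).2 (Filter.Eventually.of_forall fun s hs => ?_)
    have hs0 : 0 < s := lt_trans one_pos hs
    rw [Real.norm_eq_abs, abs_of_nonneg (by positivity)]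
    calc _ ≤ s ^ (β / 2 - 1) * s ^ (-(1 / 2) : ℝ) := by
            gcongr; exact min_le_right _ _
      _ = _ := by rw [← Real.rpow_add hs0]; congr 1; ring

lemma rep (β : ℝ) (hβ : 0 < β) (x : ℝ) :
    ∫ s in Set.Ioi (0 : ℝ), s ^ (β / 2 - 1) * Real.exp (-(s * x ^ 2)) =
      Real.Gamma (β / 2) * |x| ^ (-β) := by
  rcases eq_or_ne x 0 with rfl | hx
  · have := setIntegral_Ioi_zero_rpow (β / 2 - 1)
    simp [this, Real.zero_rpow (neg_ne_zero.2 hβ.ne')]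
  · have hx2 : 0 < x ^ 2 := by positivity
    have := Real.integral_rpow_mul_exp_neg_mul_Ioi (a := β / 2) (by positivity) hx2
    simp only [mul_comm (x ^ 2)] at this
    rw [this, mul_comm]
    congr 1
    rw [one_div, Real.inv_rpow hx2.le, ← sq_abs, ← Real.rpow_natCast, ← Real.rpow_mul (abs_nonneg x),
      Real.rpow_neg (abs_nonneg x)]
    congr 2
    push_cast; ring

lemma sqrt_inv (s : ℝ) (hs : 0 < s) : s ^ (-(1 / 2) : ℝ) = 1 / √s := by
  rw [Real.rpow_neg hs.le, ← Real.sqrt_eq_rpow, one_div]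

lemma exp_abs_le (α ξ : ℝ) : Real.exp (-|ξ| ^ α) ≤ 1 := by
  rw [Real.exp_le_one_iff]
  have : 0 ≤ |ξ| ^ α := by positivity
  linarith

lemma exp_int (μ : Measure ℝ) [IsProbabilityMeasure μ] (s : ℝ) (hs : 0 < s) (y : ℝ) :
    Integrable (fun x => Real.exp (-(s * (y + x) ^ 2))) μ := by
  refine (integrable_const (1 : ℝ)).mono' (Continuous.aestronglyMeasurable (by fun_prop)) ?_
  refine Filter.Eventually.of_forall fun x => ?_
  rw [Real.norm_eq_abs, Real.abs_exp, Real.exp_le_one_iff]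
  have : 0 ≤ s * (y + x) ^ 2 := by positivity
  linarith

lemma cos_int (α : ℝ) (hα : 0 < α) (s : ℝ) (hs : 0 < s) (y : ℝ) :
    Integrable (fun ξ : ℝ =>
      Real.cos (ξ * y) * (Real.exp (-(1 / (4 * s)) * ξ ^ 2) * Real.exp (-|ξ| ^ α))) := by
  refine (K_integrable α hα).mono' (Measurable.aestronglyMeasurable (by fun_prop)) ?_
  refine Filter.Eventually.of_forall fun ξ => ?_
  rw [norm_mul, norm_mul, Real.norm_eq_abs, Real.norm_eq_abs, Real.norm_eq_abs, Real.abs_exp,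
    Real.abs_exp]
  have h1 := Real.abs_cos_le_one (ξ * y)
  have h2 : Real.exp (-(1 / (4 * s)) * ξ ^ 2) ≤ 1 := by
    rw [Real.exp_le_one_iff]
    have : 0 ≤ (1 / (4 * s)) * ξ ^ 2 := by positivity
    linarith
  calc _ ≤ 1 * (1 * Real.exp (-|ξ| ^ α)) := by gcongr
    _ ≤ _ := by
      rw [one_mul]
      gcongr
      nlinarith [sq_nonneg ξ]

lemma bound1 (α : ℝ) (hα : 0 < α) (μ : Measure ℝ) [IsProbabilityMeasure μ]
    (h : ∀ ξ : ℝ, ∫ x : ℝ, Complex.exp (Complex.I * ξ * x) ∂μ = (Real.exp (-|ξ| ^ α) : ℂ))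
    (s : ℝ) (hs : 0 < s) (y : ℝ) :
    ∫ x, Real.exp (-(s * (y + x) ^ 2)) ∂μ ≤
      (1 + ∫ ξ : ℝ, (1 + ξ ^ 2) * Real.exp (-|ξ| ^ α)) * min 1 (s ^ (-(1 / 2) : ℝ)) := by
  set K := ∫ ξ : ℝ, (1 + ξ ^ 2) * Real.exp (-|ξ| ^ α) with hK
  have K0 : 0 ≤ K := integral_nonneg fun ξ => by positivity
  have b1 : ∫ x, Real.exp (-(s * (y + x) ^ 2)) ∂μ ≤ 1 := by
    calc _ ≤ ∫ x, (1 : ℝ) ∂μ := by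
          refine integral_mono (exp_int μ s hs y) (integrable_const _) fun x => ?_
          have : 0 ≤ s * (y + x) ^ 2 := by positivity
          simpa using this
      _ = 1 := by simp
  have b2 : √(4 * Real.pi * s) * ∫ x, Real.exp (-(s * (y + x) ^ 2)) ∂μ ≤ K := by
    rw [fourier_id α μ h s hs y]
    refine integral_mono (cos_int α hα s hs y) (K_integrable α hα) fun ξ => ?_
    have h1 := Real.cos_le_one (ξ * y)
    have h2 : Real.exp (-(1 / (4 * s)) * ξ ^ 2) ≤ 1 := by
      rw [Real.exp_le_one_iff]
      have : 0 ≤ (1 / (4 * s)) * ξ ^ 2 := by positivity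
      linarith
    calc _ ≤ 1 * (1 * Real.exp (-|ξ| ^ α)) := by
          gcongr
      _ ≤ _ := by
        rw [one_mul]
        gcongr
        nlinarith [sq_nonneg ξ]
  have E0 : 0 ≤ ∫ x, Real.exp (-(s * (y + x) ^ 2)) ∂μ := integral_nonneg fun x => by positivity
  have b3 : √s * ∫ x, Real.exp (-(s * (y + x) ^ 2)) ∂μ ≤ K := by
    refine le_trans ?_ b2
    gcongr
    nlinarith [Real.pi_gt_three]
  rw [sqrt_inv s hs]
  have hsq : 0 < √s := Real.sqrt_pos.2 hs
  rcases min_choice (1 : ℝ) (1 / √s) with e | e <;> rw [e]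
  · linarith
  · rw [mul_one_div, le_div_iff₀ hsq]
    linarith

lemma bound2 (α : ℝ) (hα : 0 < α) (μ : Measure ℝ) [IsProbabilityMeasure μ]
    (h : ∀ ξ : ℝ, ∫ x : ℝ, Complex.exp (Complex.I * ξ * x) ∂μ = (Real.exp (-|ξ| ^ α) : ℂ))
    (s : ℝ) (hs : 0 < s) (y : ℝ) :
    ∫ x, (Real.exp (-(s * (0 + x) ^ 2)) - Real.exp (-(s * (y + x) ^ 2))) ∂μ ≤
      (36 + 2 * ∫ ξ : ℝ, (1 + ξ ^ 2) * Real.exp (-|ξ| ^ α)) * min 1 (y ^ 2) *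
        min 1 (s ^ (-(1 / 2) : ℝ)) := by
  set K := ∫ ξ : ℝ, (1 + ξ ^ 2) * Real.exp (-|ξ| ^ α) with hK
  have K0 : 0 ≤ K := integral_nonneg fun ξ => by positivity
  set m := min 1 (y ^ 2) with hm
  have m0 : 0 ≤ m := by positivity
  have hcos : ∀ ξ, 1 - Real.cos (ξ * y) ≤ 2 * m * (1 + ξ ^ 2) := by
    intro ξ
    have h1 := Real.one_sub_sq_div_two_le_cos (x := ξ * y)
    have h2 := Real.neg_one_le_cos (ξ * y)
    rcases min_choice (1 : ℝ) (y ^ 2) with e | e <;> rw [hm, e] <;>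
      nlinarith [sq_nonneg ξ, sq_nonneg y, mul_nonneg (sq_nonneg ξ) (sq_nonneg y)]
  have hE : ∀ ξ : ℝ, Real.exp (-(1 / (4 * s)) * ξ ^ 2) ≤ 1 := by
    intro ξ
    rw [Real.exp_le_one_iff]
    have : 0 ≤ (1 / (4 * s)) * ξ ^ 2 := by positivity
    linarith
  rw [integral_sub (exp_int μ s hs 0) (exp_int μ s hs y)]
  set D := ∫ x, Real.exp (-(s * (0 + x) ^ 2)) ∂μ - ∫ x, Real.exp (-(s * (y + x) ^ 2)) ∂μ with hD
  have hf : √(4 * Real.pi * s) * D = ∫ ξ : ℝ, (1 - Real.cos (ξ * y)) *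
      (Real.exp (-(1 / (4 * s)) * ξ ^ 2) * Real.exp (-|ξ| ^ α)) := by
    rw [hD, mul_sub, fourier_id α μ h s hs y, fourier_id α μ h s hs 0,
      ← integral_sub (cos_int α hα s hs 0) (cos_int α hα s hs y)]
    congr 1
    ext ξ
    rw [mul_zero, Real.cos_zero]
    ring
  have hint : Integrable (fun ξ : ℝ => (1 - Real.cos (ξ * y)) *
      (Real.exp (-(1 / (4 * s)) * ξ ^ 2) * Real.exp (-|ξ| ^ α))) := by
    refine ((cos_int α hα s hs 0).sub (cos_int α hα s hs y)).congr
      (Filter.Eventually.of_forall fun ξ => ?_)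
    simp only [Pi.sub_apply]
    rw [mul_zero, Real.cos_zero]
    ring
  have hsq : 0 < √s := Real.sqrt_pos.2 hs
  have hle : √s ≤ √(4 * Real.pi * s) := Real.sqrt_le_sqrt (by nlinarith [Real.pi_gt_three])
  have D0 : 0 ≤ D := by
    have : 0 ≤ √(4 * Real.pi * s) * D := by
      rw [hf]
      refine integral_nonneg fun ξ => ?_
      have := Real.cos_le_one (ξ * y)
      have : 0 ≤ 1 - Real.cos (ξ * y) := by linarith
      dsimp only [Pi.zero_apply]
      positivity
    exact nonneg_of_mul_nonneg_right this (lt_of_lt_of_le hsq hle)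
  have b2 : √(4 * Real.pi * s) * D ≤ 2 * m * K := by
    rw [hf, hK, ← integral_const_mul]
    refine integral_mono hint ((K_integrable α hα).const_mul _) fun ξ => ?_
    calc _ ≤ (2 * m * (1 + ξ ^ 2)) * (1 * Real.exp (-|ξ| ^ α)) := by
          gcongr
          · exact hcos ξ
          · exact hE ξ
      _ = _ := by ring
  rw [sqrt_inv s hs]
  rcases le_or_gt s 1 with h1 | h1
  · have hb : 0 < 1 / (8 * s) := by positivity
    have b3 : √(4 * Real.pi * s) * D ≤ 18 * m * √(Real.pi / (1 / (8 * s))) := by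
      rw [hf, ← integral_gaussian, ← integral_const_mul]
      refine integral_mono hint ((integrable_exp_neg_mul_sq hb).const_mul _) fun ξ => ?_
      have e1 : (1 + ξ ^ 2) * Real.exp (-(1 / (4 * s)) * ξ ^ 2) ≤
          9 * Real.exp (-(1 / (8 * s)) * ξ ^ 2) := by
        have : Real.exp (-(1 / (4 * s)) * ξ ^ 2) =
            Real.exp (-(1 / (8 * s)) * ξ ^ 2) * Real.exp (-(1 / (8 * s) * ξ ^ 2)) := by
          rw [← Real.exp_add]
          congr 1
          field_simp
          ring
        rw [this]
        have h3 : (1 + ξ ^ 2) * Real.exp (-(1 / (8 * s) * ξ ^ 2)) ≤ 9 := by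
          rw [Real.exp_neg, ← div_eq_mul_inv, div_le_iff₀ (Real.exp_pos _)]
          have h4 := Real.add_one_le_exp (1 / (8 * s) * ξ ^ 2)
          have h5 : 1 / 8 ≤ 1 / (8 * s) := by
            apply one_div_le_one_div_of_le <;> linarith
          have h6 := mul_le_mul_of_nonneg_right h5 (sq_nonneg ξ)
          nlinarith [sq_nonneg ξ]
        nlinarith [Real.exp_pos (-(1 / (8 * s)) * ξ ^ 2)]
      calc _ ≤ (2 * m * (1 + ξ ^ 2)) * (Real.exp (-(1 / (4 * s)) * ξ ^ 2) * 1) := by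
            gcongr
            · exact hcos ξ
            · exact exp_abs_le α ξ
        _ = 2 * m * ((1 + ξ ^ 2) * Real.exp (-(1 / (4 * s)) * ξ ^ 2)) := by ring
        _ ≤ 2 * m * (9 * Real.exp (-(1 / (8 * s)) * ξ ^ 2)) := by gcongr
        _ = _ := by ring
    have e3 : √(Real.pi / (1 / (8 * s))) ≤ 2 * √(4 * Real.pi * s) := by
      apply Real.sqrt_le_iff.2
      refine ⟨by positivity, ?_⟩
      rw [mul_pow, Real.sq_sqrt (by positivity)]
      have : 0 < Real.pi * s := by positivity
      have e : Real.pi / (1 / (8 * s)) = 8 * (Real.pi * s) := by field_simp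
      rw [e]
      nlinarith
    have hp : 0 < √(4 * Real.pi * s) := lt_of_lt_of_le hsq hle
    have b4 : D ≤ 36 * m := by
      refine le_of_mul_le_mul_left ?_ hp
      calc _ ≤ _ := b3
        _ ≤ 18 * m * (2 * √(4 * Real.pi * s)) := by gcongr
        _ = _ := by ring
    have : (1 : ℝ) ≤ 1 / √s := by
      rw [le_div_iff₀ hsq, one_mul]
      exact Real.sqrt_le_one.2 h1
    rw [min_eq_left this]
    nlinarith [mul_nonneg K0 m0]
  · have : 1 / √s ≤ (1 : ℝ) := by
      rw [div_le_iff₀ hsq, one_mul]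
      exact Real.one_le_sqrt.2 h1.le
    rw [min_eq_right this, mul_one_div, le_div_iff₀ hsq]
    have := mul_le_mul_of_nonneg_right hle D0
    nlinarith

lemma prod_int (α : ℝ) (hα : 0 < α) (μ : Measure ℝ) [IsProbabilityMeasure μ]
    (h : ∀ ξ : ℝ, ∫ x : ℝ, Complex.exp (Complex.I * ξ * x) ∂μ = (Real.exp (-|ξ| ^ α) : ℂ))
    (β : ℝ) (hβ : β ∈ Set.Ioo (0 : ℝ) 1) (y : ℝ) :
    Integrable (fun p : ℝ × ℝ => p.2 ^ (β / 2 - 1) * Real.exp (-(p.2 * (y + p.1) ^ 2)))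
      (μ.prod (volume.restrict (Set.Ioi 0))) := by
  have hm : AEStronglyMeasurable
      (fun p : ℝ × ℝ => p.2 ^ (β / 2 - 1) * Real.exp (-(p.2 * (y + p.1) ^ 2)))
      (μ.prod (volume.restrict (Set.Ioi 0))) := Measurable.aestronglyMeasurable (by fun_prop)
  rw [integrable_prod_iff' hm]
  constructor
  · refine (ae_restrict_iff' measurableSet_Ioi).2 (Filter.Eventually.of_forall fun s hs => ?_)
    exact (exp_int μ s hs y).const_mul (s ^ (β / 2 - 1))
  · refine ((g_integrable β hβ).const_mul
      (1 + ∫ ξ : ℝ, (1 + ξ ^ 2) * Real.exp (-|ξ| ^ α))).mono' ?_ ?_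
    · exact hm.norm.prod_swap.integral_prod_right'
    · refine (ae_restrict_iff' measurableSet_Ioi).2 (Filter.Eventually.of_forall fun s hs => ?_)
      have hs0 : 0 < s := hs
      rw [Real.norm_eq_abs, abs_of_nonneg (integral_nonneg fun x => norm_nonneg _)]
      have : ∀ x : ℝ, ‖s ^ (β / 2 - 1) * Real.exp (-(s * (y + x) ^ 2))‖ =
          s ^ (β / 2 - 1) * Real.exp (-(s * (y + x) ^ 2)) := fun x => by
        rw [Real.norm_eq_abs, abs_of_nonneg (by positivity)]
      simp only [this]
      rw [integral_const_mul]
      calc _ ≤ _ := mul_le_mul_of_nonneg_left (bound1 α hα μ h s hs y)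
            (Real.rpow_nonneg hs0.le _)
        _ = _ := by ring

/-- For a standard symmetric `α`-stable law `μ` and `β ∈ (0,1)`,
`E(|ξ|^{-β} − |y + ξ|^{-β}) ≤ C min(1, y²)` for all `y > 0`. -/
theorem stable_negative_moment_difference_bound (α β : ℝ) (hα : α ∈ Set.Ioc (0 : ℝ) 2)
    (hβ : β ∈ Set.Ioo (0 : ℝ) 1) :
    ∃ C : ℝ, 0 < C ∧ ∀ μ : Measure ℝ, IsProbabilityMeasure μ →
      (∀ ξ : ℝ, ∫ x : ℝ, Complex.exp (Complex.I * ξ * x) ∂μ = (Real.exp (-|ξ| ^ α) : ℂ)) →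
      ∀ y : ℝ, 0 < y →
        ∫ x : ℝ, (|x| ^ (-β) - |y + x| ^ (-β)) ∂μ ≤ C * min 1 (y ^ 2) := by
  have hG := Real.Gamma_pos_of_pos (s := β / 2) (by linarith [hβ.1])
  set G := Real.Gamma (β / 2) with hGdef
  set K := ∫ ξ : ℝ, (1 + ξ ^ 2) * Real.exp (-|ξ| ^ α) with hK
  have K0 : 0 ≤ K := integral_nonneg fun ξ => by positivity
  set J := ∫ s in Set.Ioi (0 : ℝ), s ^ (β / 2 - 1) * min 1 (s ^ (-(1 / 2) : ℝ)) with hJ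
  have J0 : 0 ≤ J := by
    refine setIntegral_nonneg measurableSet_Ioi fun s hs => ?_
    have hs0 : (0 : ℝ) < s := hs
    positivity
  refine ⟨(36 + 2 * K) * (J + 1) / G, by positivity, fun μ hμ h y hy => ?_⟩
  have m0 : 0 ≤ min 1 (y ^ 2) := by positivity
  have i0 := prod_int α hα.1 μ h β hβ 0
  have iy := prod_int α hα.1 μ h β hβ y
  have isub := i0.sub iy
  have sw := integral_integral_swap (μ := μ) (ν := volume.restrict (Set.Ioi 0))
    (f := fun (x s : ℝ) => s ^ (β / 2 - 1) * Real.exp (-(s * (0 + x) ^ 2)) -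
      s ^ (β / 2 - 1) * Real.exp (-(s * (y + x) ^ 2))) isub
  have e1 : ∫ x, G * (|x| ^ (-β) - |y + x| ^ (-β)) ∂μ =
      ∫ x, (∫ s in Set.Ioi (0 : ℝ), (s ^ (β / 2 - 1) * Real.exp (-(s * (0 + x) ^ 2)) -
      s ^ (β / 2 - 1) * Real.exp (-(s * (y + x) ^ 2)))) ∂μ := by
    refine integral_congr_ae ?_
    filter_upwards [i0.prod_right_ae, iy.prod_right_ae] with x hx0 hxy
    rw [integral_sub hx0 hxy, rep β hβ.1, rep β hβ.1, zero_add, mul_sub]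
  rw [sw, integral_const_mul] at e1
  have e2 : ∫ s in Set.Ioi (0 : ℝ), ∫ x, (s ^ (β / 2 - 1) * Real.exp (-(s * (0 + x) ^ 2)) -
      s ^ (β / 2 - 1) * Real.exp (-(s * (y + x) ^ 2))) ∂μ ≤
      ((36 + 2 * K) * min 1 (y ^ 2)) * J := by
    rw [hJ, ← integral_const_mul]
    refine setIntegral_mono_on isub.integral_prod_right ((g_integrable β hβ).const_mul _)
      measurableSet_Ioi fun s hs => ?_
    have hs0 : (0 : ℝ) < s := hs
    simp only [← mul_sub]
    rw [integral_const_mul]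
    calc _ ≤ _ := mul_le_mul_of_nonneg_left (bound2 α hα.1 μ h s hs y)
            (Real.rpow_nonneg hs0.le _)
      _ = _ := by ring
  rw [← e1] at e2
  rw [div_mul_eq_mul_div, le_div_iff₀ hG, mul_comm]
  refine e2.trans ?_
  have : 0 ≤ (36 + 2 * K) * min 1 (y ^ 2) := by positivity
  nlinarith
end
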